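/- arXiv:1710.08167 — 2 statements merged into one kernel-verified Lean document; each statement's English description precedes it below -/
import Mathlib

section
/- Let q be a probability measure on a measurable space Ω, let f₁,…,f_k : Ω → ℝ be measurable functions, and let λ₁,…,λ_k ∈ ℝ be such that Z = ∫ exp(∑_{t=1}^k λ_t f_t) dq < ∞. Let p* be the probability measure with density exp(∑_{t=1}^k λ_t f_t)/Z with respect to q, and assume each f_t is p*-integrable. If p is a probability measure absolutely continuous with respect to q such that each f_t is p-integrable, ∫ f_t dp = ∫ f_t dp* for all t ∈ {1,…,k}, and KL(p‖q) = KL(p*‖q) < ∞, then p = p*. That is, the maximum entropy distribution subject to the expectation constraints is unique. -/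
open MeasureTheory Real
open scoped Classical

/-- Kullback–Leibler divergence `KL(p‖q) = ∫ log (dp/dq) dp`, valued in `ℝ≥0∞`:
it is the integral of the log of the Radon–Nikodym derivative when `p ≪ q` and this
log-likelihood ratio is `p`-integrable, and `∞` otherwise. -/
noncomputable def klDiv {Ω : Type*} [MeasurableSpace Ω] (p q : Measure Ω) : ENNReal :=
  if p ≪ q ∧ Integrable (fun x => Real.log (p.rnDeriv q x).toReal) p
  then ENNReal.ofReal (∫ x, Real.log (p.rnDeriv q x).toReal ∂p)
  else ⊤

lemma klDiv_fin_aux {Ω : Type*} [MeasurableSpace Ω] (p q : Measure Ω)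
    [IsProbabilityMeasure p] [IsProbabilityMeasure q] (h : klDiv p q < ⊤) :
    p ≪ q ∧ Integrable (llr p q) p ∧ klDiv p q = InformationTheory.klDiv p q := by
  unfold klDiv at h ⊢
  split_ifs at h ⊢ with h1
  · refine ⟨h1.1, h1.2, ?_⟩
    rw [InformationTheory.klDiv_of_ac_of_integrable h1.1 h1.2]
    simp [llr_def]
  · simp at h

/-- Uniqueness of the maximum entropy distribution: if a probability measure `p ≪ q`
satisfies the same expectation constraints as the tilted measure
`p* = exp(∑ λ_t f_t)/Z · q` and attains the same (finite) KL divergence from `q`,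
then `p = p*`. -/
theorem maxEnt_tilted_unique
    {Ω : Type*} [MeasurableSpace Ω] (q : Measure Ω) [IsProbabilityMeasure q]
    (k : ℕ) (f : Fin k → Ω → ℝ) (hf : ∀ t, Measurable (f t))
    (lam : Fin k → ℝ)
    (hZ : Integrable (fun ω => Real.exp (∑ t, lam t * f t ω)) q)
    (pstar : Measure Ω)
    (hpstar : pstar = q.tilted (fun ω => ∑ t, lam t * f t ω))
    (hfint : ∀ t, Integrable (f t) pstar)
    (p : Measure Ω) (hp : IsProbabilityMeasure p) (hpq : p ≪ q)
    (hpint : ∀ t, Integrable (f t) p)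
    (hmoments : ∀ t, ∫ ω, f t ω ∂p = ∫ ω, f t ω ∂pstar)
    (hKLeq : klDiv p q = klDiv pstar q)
    (hKLfin : klDiv pstar q < ⊤) :
    p = pstar := by
  have hpsP : IsProbabilityMeasure pstar := by
    rw [hpstar]; exact isProbabilityMeasure_tilted hZ
  obtain ⟨-, hi1, he1⟩ := klDiv_fin_aux p q (hKLeq ▸ hKLfin)
  obtain ⟨hac2, hi2, he2⟩ := klDiv_fin_aux pstar q hKLfin
  have hI : ∫ x, llr p q x ∂p = ∫ x, llr pstar q x ∂pstar := by
    rw [← InformationTheory.toReal_klDiv_of_measure_eq hpq (by simp),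
      ← InformationTheory.toReal_klDiv_of_measure_eq hac2 (by simp), ← he1, ← he2, hKLeq]
  have hF1 : Integrable (fun ω => ∑ t, lam t * f t ω) p :=
    integrable_finsetSum _ fun t _ => (hpint t).const_mul _
  have hF2 : Integrable (fun ω => ∑ t, lam t * f t ω) pstar :=
    integrable_finsetSum _ fun t _ => (hfint t).const_mul _
  have hFeq : ∫ ω, ∑ t, lam t * f t ω ∂p = ∫ ω, ∑ t, lam t * f t ω ∂pstar := by
    rw [integral_finsetSum _ fun t _ => (hpint t).const_mul _,
      integral_finsetSum _ fun t _ => (hfint t).const_mul _]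
    simp only [integral_const_mul, hmoments]
  have e1 := integral_llr_tilted_right hpq hF1 hZ hi1
  have e2 := integral_llr_tilted_right hac2 hF2 hZ hi2
  have i1 := integrable_llr_tilted_right hpq hF1 hi1 hZ
  rw [← hpstar] at e1 e2 i1
  have z : ∫ x, llr pstar pstar x ∂pstar = 0 := by
    rw [integral_congr_ae (llr_self pstar)]; simp
  have z1 : ∫ x, llr p pstar x ∂p = 0 := by
    rw [e1, hI, hFeq, ← e2, z]
  have hac : p ≪ pstar := by
    rw [hpstar]; exact hpq.trans (absolutelyContinuous_tilted hZ)
  rw [← InformationTheory.klDiv_eq_zero_iff,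
    InformationTheory.klDiv_of_ac_of_integrable hac i1, z1]
  simp
end

section
/- Let d ≥ 1, let I be a nonempty finite index set, and for each i ∈ I let m̃_i ∈ ℝ^d and let Σ̃_i be a positive definite real d×d matrix. Let w ∈ ℝ^d be such that S := ∑_{i∈I} wᵀ Σ̃_i w > 0, let v̂ ∈ ℝ, and set λ = (v̂ − ∑_{i∈I} wᵀ m̃_i) / S. Let q = ⨂_{i∈I} N(m̃_i, Σ̃_i) be the product measure on (ℝ^d)^I, and let p be the probability measure with density proportional to exp(λ ∑_{i∈I} wᵀ x_i) with respect to q. Then p = ⨂_{i∈I} N(m̃_i + λ Σ̃_i w, Σ̃_i), and the constraint is satisfied in expectation: ∫ ∑_{i∈I} wᵀ x_i dp(x) = v̂. -/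
open MeasureTheory Matrix Real

/-- The multivariate Gaussian measure `N(m, S)` on `ℝ^d` (for `S` positive definite),
defined by its density with respect to Lebesgue measure. -/
noncomputable def multiGaussian (d : ℕ) (m : Fin d → ℝ) (S : Matrix (Fin d) (Fin d) ℝ) :
    Measure (Fin d → ℝ) :=
  volume.withDensity fun x =>
    ENNReal.ofReal ((Real.sqrt ((2 * Real.pi) ^ d * S.det))⁻¹ *
      Real.exp (-((x - m) ⬝ᵥ (S⁻¹ *ᵥ (x - m))) / 2))


open ProbabilityTheory in
theorem aux_pi_withDensity {ι : Type*} [Fintype ι] {X : ι → Type*} [∀ i, MeasurableSpace (X i)]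
    (μ : ∀ i, Measure (X i)) [∀ i, SigmaFinite (μ i)] (f : ∀ i, X i → ℝ)
    (hf0 : ∀ i x, 0 ≤ f i x) (hf : ∀ i, Integrable (f i) (μ i)) :
    Measure.pi (fun i => (μ i).withDensity fun x => ENNReal.ofReal (f i x))
      = (Measure.pi μ).withDensity fun x => ENNReal.ofReal (∏ i, f i (x i)) := by
  have : ∀ i, IsFiniteMeasure ((μ i).withDensity fun x => ENNReal.ofReal (f i x)) := fun i =>
    isFiniteMeasure_withDensity_ofReal (hf i).2
  symm
  refine (Measure.pi_eq (fun s hs => ?_)).symm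
  rw [withDensity_apply _ (MeasurableSet.univ_pi hs), Measure.restrict_pi_pi,
    ← ofReal_integral_eq_lintegral_ofReal, integral_fintype_prod_eq_prod,
    ENNReal.ofReal_prod_of_nonneg (fun i _ => integral_nonneg (hf0 i))]
  · refine Finset.prod_congr rfl fun i _ => ?_
    rw [withDensity_apply _ (hs i), ofReal_integral_eq_lintegral_ofReal (hf i).integrableOn
      (Filter.Eventually.of_forall (hf0 i))]
  · exact Integrable.fintype_prod_dep (fun i => (hf i).integrableOn)
  · exact Filter.Eventually.of_forall fun x => Finset.prod_nonneg fun i _ => hf0 i _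

open ProbabilityTheory in
theorem aux_map (d : ℕ) (m : Fin d → ℝ) (S A : Matrix (Fin d) (Fin d) ℝ)
    (hA : S = A * Aᵀ) (hdet : A.det ≠ 0) :
    multiGaussian d m S
      = (Measure.pi fun _ : Fin d => gaussianReal 0 1).map (fun y => A *ᵥ y + m) := by
  have hT : Measurable (fun y : Fin d → ℝ => A *ᵥ y + m) := by fun_prop
  have hν : (Measure.pi fun _ : Fin d => gaussianReal 0 1)
      = volume.withDensity fun y : Fin d → ℝ =>
        ENNReal.ofReal (∏ i, gaussianPDFReal 0 1 (y i)) := by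
    rw [volume_pi, ← aux_pi_withDensity _ (fun _ => gaussianPDFReal 0 1)
      (fun _ => gaussianPDFReal_nonneg 0 1) (fun _ => integrable_gaussianPDFReal 0 1)]
    congr 1
    funext i
    rw [gaussianReal_of_var_ne_zero _ one_ne_zero]; rfl
  have hvol : (volume : Measure (Fin d → ℝ)) =
      ENNReal.ofReal |A.det| • volume.map (fun y => A *ᵥ y + m) := by
    have h1 : (volume : Measure (Fin d → ℝ)).map (fun y => A *ᵥ y + m)
        = ((volume : Measure (Fin d → ℝ)).map (Matrix.toLin' A)).map (fun x => x + m) := by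
      rw [Measure.map_map (by fun_prop)
        (LinearMap.continuous_of_finiteDimensional (Matrix.toLin' A)).measurable]
      rfl
    rw [h1, Real.map_matrix_volume_pi_eq_smul_volume_pi hdet, Measure.map_smul,
      map_add_right_eq_self, smul_smul, ← ENNReal.ofReal_mul (abs_nonneg _), ← abs_mul,
      mul_inv_cancel₀ hdet]
    simp
  have hSi : Aᵀ * S⁻¹ * A = 1 := by
    have h2 : IsUnit A.det := hdet.isUnit
    have h3 : IsUnit Aᵀ.det := by rw [det_transpose]; exact h2
    rw [hA, Matrix.mul_inv_rev, ← Matrix.mul_assoc, Matrix.mul_nonsing_inv _ h3, Matrix.one_mul,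
      Matrix.nonsing_inv_mul _ h2]
  have hq : ∀ y, (A *ᵥ y) ⬝ᵥ (S⁻¹ *ᵥ (A *ᵥ y)) = ∑ i, y i ^ 2 := by
    intro y
    rw [dotProduct_comm, Matrix.mulVec_mulVec, Matrix.dotProduct_mulVec, ← Matrix.mulVec_transpose,
      Matrix.mulVec_mulVec, ← Matrix.mul_assoc, hSi, Matrix.one_mulVec]
    simp [dotProduct, sq]
  have hSd : S.det = A.det ^ 2 := by rw [hA, det_mul, det_transpose, sq]
  ext s hs
  rw [Measure.map_apply hT hs, hν, withDensity_apply _ (hT hs), multiGaussian,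
    withDensity_apply _ hs]
  conv_lhs => rw [hvol]
  rw [Measure.restrict_smul, lintegral_smul_measure, setLIntegral_map hs (by fun_prop) hT,
    smul_eq_mul, ← lintegral_const_mul _ (by fun_prop)]
  congr 1
  funext y
  rw [← ENNReal.ofReal_mul (abs_nonneg _)]
  congr 1
  rw [add_sub_cancel_right, hq, hSd, Real.sqrt_mul (by positivity), Real.sqrt_sq_eq_abs, mul_inv]
  have : |A.det| ≠ 0 := abs_ne_zero.mpr hdet
  simp only [gaussianPDFReal, Finset.prod_mul_distrib, ← Real.exp_sum]
  rw [Finset.prod_const, Finset.card_univ, Fintype.card_fin]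
  have h5 : √((2 * π) ^ d) = √(2 * π) ^ d := by
    rw [Real.sqrt_eq_iff_mul_self_eq (by positivity) (by positivity), ← mul_pow,
      Real.mul_self_sqrt (by positivity)]
  rw [h5]
  simp only [NNReal.coe_one, mul_one, sub_zero, inv_pow, ← Finset.sum_div,
    Finset.sum_neg_distrib]
  field_simp

open ProbabilityTheory in
open scoped MatrixOrder Matrix.Norms.L2Operator in
theorem aux_facts (d : ℕ) (m w : Fin d → ℝ) (S : Matrix (Fin d) (Fin d) ℝ) (hS : S.PosDef) :
    IsProbabilityMeasure (multiGaussian d m S) ∧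
    Integrable (fun x => w ⬝ᵥ x) (multiGaussian d m S) ∧
    ∫ x, w ⬝ᵥ x ∂(multiGaussian d m S) = w ⬝ᵥ m := by
  obtain ⟨B, hB⟩ := CStarAlgebra.nonneg_iff_eq_star_mul_self.mp hS.posSemidef.nonneg
  have hA : S = Bᵀ * Bᵀᵀ := by simpa [Matrix.star_eq_conjTranspose] using hB
  have hdet : Bᵀ.det ≠ 0 := by
    intro h
    have := hS.det_pos
    rw [hA, det_mul, h, zero_mul] at this
    exact lt_irrefl _ this
  rw [aux_map d m S Bᵀ hA hdet]
  set A := Bᵀ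
  have hT : Measurable (fun y : Fin d → ℝ => A *ᵥ y + m) := by fun_prop
  have hfun : ∀ y : Fin d → ℝ, w ⬝ᵥ (A *ᵥ y + m) = ∑ i, (w ᵥ* A) i * y i + w ⬝ᵥ m := by
    intro y
    rw [dotProduct_add, Matrix.dotProduct_mulVec]; rfl
  have hid : Integrable (fun x : ℝ => x) (gaussianReal 0 1) :=
    (memLp_id_gaussianReal 1).integrable (by simp)
  have hi : ∀ i : Fin d, Integrable (fun y : Fin d → ℝ => (w ᵥ* A) i * y i)
      (Measure.pi fun _ : Fin d => gaussianReal 0 1) := fun i =>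
    (integrable_comp_eval (μ := fun _ : Fin d => gaussianReal 0 1) (i := i) hid).const_mul _
  have hsum := integrable_finsetSum Finset.univ (fun i _ => hi i)
  refine ⟨Measure.isProbabilityMeasure_map hT.aemeasurable, ?_, ?_⟩
  · rw [integrable_map_measure (by fun_prop) hT.aemeasurable]
    simp only [Function.comp_def, hfun]
    exact hsum.add (integrable_const _)
  · rw [integral_map hT.aemeasurable (by fun_prop)]
    simp only [hfun]
    rw [integral_add hsum (integrable_const _), integral_finsetSum _ (fun i _ => hi i)]
    have : ∀ i : Fin d, ∫ y : Fin d → ℝ, (w ᵥ* A) i * y i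
      ∂(Measure.pi fun _ : Fin d => gaussianReal 0 1) = 0 := by
      intro i
      rw [integral_const_mul, integral_comp_eval (μ := fun _ : Fin d => gaussianReal 0 1) (i := i)
        (f := fun x : ℝ => x) hid.aestronglyMeasurable, integral_id_gaussianReal, mul_zero]
    simp [this]

theorem aux_tilt (d : ℕ) (m w : Fin d → ℝ) (S : Matrix (Fin d) (Fin d) ℝ) (hS : S.PosDef)
    (lam : ℝ) :
    multiGaussian d (m + lam • (S *ᵥ w)) S = (multiGaussian d m S).withDensity fun x =>
      ENNReal.ofReal (exp (lam * (w ⬝ᵥ x)) /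
        exp (lam * (w ⬝ᵥ m) + lam ^ 2 * (w ⬝ᵥ (S *ᵥ w)) / 2)) := by
  unfold multiGaussian
  rw [← withDensity_mul _ (by fun_prop) (by fun_prop)]
  congr 1
  funext x
  rw [Pi.mul_apply, ← ENNReal.ofReal_mul (by positivity), mul_assoc, ← Real.exp_sub, ← Real.exp_add]
  congr 3
  have hu : IsUnit S.det := hS.det_pos.ne'.isUnit
  have hsym : Sᵀ = S := by simpa using hS.isHermitian.eq
  have e0 : x - (m + lam • (S *ᵥ w)) = (x - m) - lam • (S *ᵥ w) := by abel
  have e1 : S⁻¹ *ᵥ (S *ᵥ w) = w := by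
    rw [Matrix.mulVec_mulVec, Matrix.nonsing_inv_mul _ hu, Matrix.one_mulVec]
  have e2 : ∀ u : Fin d → ℝ, (S *ᵥ w) ⬝ᵥ (S⁻¹ *ᵥ u) = w ⬝ᵥ u := by
    intro u
    conv_lhs => rw [← hsym, Matrix.mulVec_transpose, ← Matrix.dotProduct_mulVec,
      Matrix.mulVec_mulVec, hsym, Matrix.mul_nonsing_inv _ hu, Matrix.one_mulVec]
  have e3 : w ⬝ᵥ x = w ⬝ᵥ (x - m) + w ⬝ᵥ m := by rw [dotProduct_sub]; ring
  rw [e0, e3]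
  generalize x - m = u
  rw [Matrix.mulVec_sub, Matrix.mulVec_smul, e1, sub_dotProduct, dotProduct_sub, dotProduct_sub,
    smul_dotProduct, smul_dotProduct, e2, dotProduct_smul, dotProduct_smul,
    dotProduct_comm u w, dotProduct_comm (S *ᵥ w) w]
  simp only [smul_eq_mul]
  ring

/-- Updating a product Gaussian background distribution for a linear constraint:
tilting `⨂_{i∈I} N(m̃_i, Σ̃_i)` by `exp(λ ∑_{i∈I} wᵀ x_i)` with
`λ = (v̂ − ∑ wᵀ m̃_i) / ∑ wᵀ Σ̃_i w` yields `⨂_{i∈I} N(m̃_i + λ Σ̃_i w, Σ̃_i)`,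
and the linear constraint is satisfied in expectation. -/
theorem product_gaussian_linear_constraint_update
    {ι : Type*} [Fintype ι] [Nonempty ι] (d : ℕ) (hd : 1 ≤ d)
    (mt : ι → Fin d → ℝ) (St : ι → Matrix (Fin d) (Fin d) ℝ)
    (hSt : ∀ i, (St i).PosDef) (w : Fin d → ℝ)
    (hS : 0 < ∑ i, w ⬝ᵥ (St i *ᵥ w))
    (vhat : ℝ) (lam : ℝ)
    (hlam : lam = (vhat - ∑ i, w ⬝ᵥ mt i) / (∑ i, w ⬝ᵥ (St i *ᵥ w))) :
    (Measure.pi fun i => multiGaussian d (mt i) (St i)).tilted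
        (fun x => lam * ∑ i, w ⬝ᵥ x i)
      = (Measure.pi fun i => multiGaussian d (mt i + lam • (St i *ᵥ w)) (St i)) ∧
    ∫ x, (∑ i, w ⬝ᵥ x i)
        ∂((Measure.pi fun i => multiGaussian d (mt i) (St i)).tilted
            (fun x => lam * ∑ i, w ⬝ᵥ x i))
      = vhat := by
  have hP : ∀ i (m : Fin d → ℝ), IsProbabilityMeasure (multiGaussian d m (St i)) :=
    fun i m => (aux_facts d m w (St i) (hSt i)).1
  have key : (Measure.pi fun i => multiGaussian d (mt i) (St i)).tilted
        (fun x => lam * ∑ i, w ⬝ᵥ x i)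
      = (Measure.pi fun i => multiGaussian d (mt i + lam • (St i *ᵥ w)) (St i)) := by
    have hprob : IsProbabilityMeasure
      (Measure.pi fun i => multiGaussian d (mt i + lam • (St i *ᵥ w)) (St i)) := inferInstance
    have hP2 := fun i => hP i (mt i + lam • (St i *ᵥ w))
    simp only [fun i => aux_tilt d (mt i) w (St i) (hSt i) lam] at hprob hP2 ⊢
    have hint : ∀ i, Integrable (fun x => exp (lam * (w ⬝ᵥ x)) /
        exp (lam * (w ⬝ᵥ mt i) + lam ^ 2 * (w ⬝ᵥ (St i *ᵥ w)) / 2))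
        (multiGaussian d (mt i) (St i)) := by
      intro i
      refine ⟨Measurable.aestronglyMeasurable (by fun_prop), ?_⟩
      rw [hasFiniteIntegral_iff_ofReal (Filter.Eventually.of_forall fun x => by positivity)]
      have h1 := (hP2 i).measure_univ
      rw [withDensity_apply _ MeasurableSet.univ, Measure.restrict_univ] at h1
      rw [h1]; exact ENNReal.one_lt_top
    rw [aux_pi_withDensity (fun i => multiGaussian d (mt i) (St i))
      (fun i x => exp (lam * (w ⬝ᵥ x)) /
        exp (lam * (w ⬝ᵥ mt i) + lam ^ 2 * (w ⬝ᵥ (St i *ᵥ w)) / 2))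
      (fun i x => by positivity) hint] at hprob ⊢
    · simp only [Finset.prod_div_distrib, ← Real.exp_sum, ← Finset.mul_sum] at hprob ⊢
      set C := exp (∑ i, (lam * (w ⬝ᵥ mt i) + lam ^ 2 * (w ⬝ᵥ (St i *ᵥ w)) / 2)) with hC
      have hCpos : 0 < C := exp_pos _
      have h1 := hprob.measure_univ
      rw [withDensity_apply _ MeasurableSet.univ, Measure.restrict_univ] at h1
      have h2 : ∫ x : ι → Fin d → ℝ, exp (lam * ∑ i, w ⬝ᵥ x i) / C
          ∂(Measure.pi fun i => multiGaussian d (mt i) (St i)) = 1 := by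
        rw [integral_eq_lintegral_of_nonneg_ae
          (Filter.Eventually.of_forall fun x => by positivity)
          (Measurable.aestronglyMeasurable (by fun_prop)), h1]
        simp
      rw [integral_div, div_eq_one_iff_eq hCpos.ne'] at h2
      rw [Measure.tilted, h2]
  refine ⟨key, ?_⟩
  rw [key]
  have hF := fun i => aux_facts d (mt i + lam • (St i *ᵥ w)) w (St i) (hSt i)
  rw [integral_finsetSum]
  · have : ∀ i, ∫ x : ι → Fin d → ℝ, w ⬝ᵥ x i
        ∂(Measure.pi fun i => multiGaussian d (mt i + lam • (St i *ᵥ w)) (St i))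
        = w ⬝ᵥ mt i + lam * (w ⬝ᵥ (St i *ᵥ w)) := by
      intro i
      rw [integral_comp_eval (μ := fun i => multiGaussian d (mt i + lam • (St i *ᵥ w)) (St i))
        (i := i) (f := fun x => w ⬝ᵥ x) (hF i).2.1.aestronglyMeasurable, (hF i).2.2,
        dotProduct_add, dotProduct_smul, smul_eq_mul]
    simp only [this]
    rw [Finset.sum_add_distrib, ← Finset.mul_sum, hlam, div_mul_cancel₀ _ hS.ne']
    ring
  · intro i _
    exact integrable_comp_eval (μ := fun i => multiGaussian d (mt i + lam • (St i *ᵥ w)) (St i))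
        (i := i) (f := fun x => w ⬝ᵥ x) (hF i).2.1
end
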